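/- Let Δ be a maximal order over the ring of integers O_F of a number field F in a finite-dimensional central division F-algebra D, and let M be a full left Δ-lattice in D with inverse M^{-1} := {x ∈ D | M·x·M ⊆ M}. Then M·M^{-1} equals the left order O_l(M) of M and M^{-1}·M equals the right order O_r(M) of M, and (M^{-1})^{-1} = M. -/

import Mathlib

/-!
STATEMENT 0: Let Δ be a maximal order over O_F in a finite-dimensional central division
F-algebra D, and M a full left Δ-lattice in D with M⁻¹ = {x | M·x·M ⊆ M}.  Then
M·M⁻¹ = O_l(M), M⁻¹·M = O_r(M), and (M⁻¹)⁻¹ = M.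
-/

open NumberField Pointwise

noncomputable section

/-- The left order `O_l(M) = {x ∈ D | xM ⊆ M}` of a subset `M` of `D`. -/
def leftOrderSet {D : Type} [DivisionRing D] (M : Set D) : Set D :=
  {x | ∀ m ∈ M, x * m ∈ M}

/-- The right order `O_r(M) = {x ∈ D | Mx ⊆ M}` of a subset `M` of `D`. -/
def rightOrderSet {D : Type} [DivisionRing D] (M : Set D) : Set D :=
  {x | ∀ m ∈ M, m * x ∈ M}

/-- The inverse `M⁻¹ = {x ∈ D | M·x·M ⊆ M}` of a subset `M` of `D`. -/
def invSet {D : Type} [DivisionRing D] (M : Set D) : Set D :=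
  {x | ∀ m ∈ M, ∀ m' ∈ M, m * x * m' ∈ M}

/-- A full `O_F`-lattice in `D`: finitely generated over `O_F` and spanning `D` over `F`. -/
def IsFullLattice (F D : Type) [Field F] [NumberField F] [Ring D] [Algebra F D]
    [Algebra (𝓞 F) D] (M : Submodule (𝓞 F) D) : Prop :=
  M.FG ∧ Submodule.span F (M : Set D) = ⊤

/-- An `O_F`-order in `D`: a subring, stable under `O_F`, which is a full lattice. -/
def IsOrder (F D : Type) [Field F] [NumberField F] [Ring D] [Algebra F D]
    [Algebra (𝓞 F) D] (Λ : Subalgebra (𝓞 F) D) : Prop :=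
  IsFullLattice F D (Subalgebra.toSubmodule Λ)

/-- A maximal `O_F`-order in `D`. -/
def IsMaximalOrder (F D : Type) [Field F] [NumberField F] [Ring D] [Algebra F D]
    [Algebra (𝓞 F) D] (Λ : Subalgebra (𝓞 F) D) : Prop :=
  IsOrder F D Λ ∧ ∀ Λ' : Subalgebra (𝓞 F) D, IsOrder F D Λ' → Λ ≤ Λ' → Λ' = Λ

theorem primeArtin_idem {Q : Type*} [Ring Q] [IsArtinianRing Q]
    (hp : ∀ a b : Q, (∀ r, a * r * b = 0) → a = 0 ∨ b = 0) (L : Ideal Q) :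
    ∃ e ∈ L, ∀ a ∈ L, a * (1 - e) = 0 := by
  have hJ : Ring.jacobson Q = ⊥ := by
    by_contra hne
    obtain ⟨n, hn⟩ := (IsSemiprimaryRing.isNilpotent : IsNilpotent (Ring.jacobson Q))
    have key : ∀ n : ℕ, (Ring.jacobson Q) ^ n = 0 → False := by
      intro n
      induction n with
      | zero =>
        intro h
        apply hne
        rw [Submodule.pow_zero] at h
        have h1 : (1 : Q) ∈ (⊥ : Ideal Q) := by
          have : (⊥ : Ideal Q) = 1 := h.symm
          rw [this, Ideal.one_eq_top]; trivial
        rw [eq_bot_iff]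
        intro x _
        have := (⊥ : Ideal Q).mul_mem_left x h1
        simpa using this
      | succ n ih =>
        intro h
        apply ih
        obtain ⟨a, ha, ha0⟩ := (Submodule.ne_bot_iff _).1 hne
        rw [← le_zero_iff]
        intro b hb
        have : a = 0 ∨ b = 0 := by
          apply hp
          intro r
          have h2 : a * (r * b) ∈ Ring.jacobson Q * (Ring.jacobson Q) ^ n :=
            Ideal.mul_mem_mul ha (Ideal.mul_mem_left _ r hb)
          have h3 : Ring.jacobson Q * (Ring.jacobson Q) ^ n = 0 := by
            rw [← Ideal.IsTwoSided.pow_succ, h]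
          rw [h3] at h2
          rw [mul_assoc]; exact h2
        rcases this with h | h
        · exact absurd h ha0
        · rw [h]; exact Submodule.zero_mem _
    exact key n hn
  have hs : IsSemisimpleRing Q := IsArtinianRing.isSemisimpleRing_iff_jacobson.2 hJ
  obtain ⟨T, hT⟩ := exists_isCompl L
  have h1 : (1 : Q) ∈ L ⊔ T := by rw [hT.sup_eq_top]; trivial
  obtain ⟨e, he, f, hf, hef⟩ := Submodule.mem_sup.1 h1
  refine ⟨e, he, fun a ha => ?_⟩
  have hfe : 1 - e = f := by rw [← hef]; abel
  have m1 : a * (1 - e) ∈ T := by rw [hfe]; exact T.mul_mem_left a hf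
  have m2 : a * (1 - e) ∈ L := by
    rw [mul_sub, mul_one]; exact L.sub_mem ha (L.mul_mem_left a he)
  have : a * (1 - e) ∈ L ⊓ T := ⟨m2, m1⟩
  rw [hT.inf_eq_bot] at this
  simpa using this

/-- Abstract properties of a maximal order used in the proof. -/
structure GoodOrd (R D : Type*) [CommRing R] [DivisionRing D] [Algebra R D]
    (Δ : Subalgebra R D) : Prop where
  noeth : IsNoetherianRing R
  inj : ∀ r : R, algebraMap R D r = 0 → r = 0
  fg : (Subalgebra.toSubmodule Δ).FG
  den : ∀ x : D, ∃ r : R, r ≠ 0 ∧ r • x ∈ Δ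
  fin : ∀ r : R, r ≠ 0 → Finite (R ⧸ Ideal.span {r})
  rt : ∀ B : Submodule R D, B.FG → B ≠ ⊥ → B * Subalgebra.toSubmodule Δ ≤ B →
    ∀ x : D, (∀ b ∈ B, b * x ∈ B) → x ∈ Δ
  lt : ∀ B : Submodule R D, B.FG → B ≠ ⊥ → Subalgebra.toSubmodule Δ * B ≤ B →
    ∀ x : D, (∀ b ∈ B, x * b ∈ B) → x ∈ Δ

/-- Nonzero two-sided integral ideals. -/
structure TS {R D : Type*} [CommRing R] [DivisionRing D] [Algebra R D]
    (Δ : Subalgebra R D) (I : Submodule R D) : Prop where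
  le : ∀ x ∈ I, x ∈ Δ
  ml : ∀ a ∈ Δ, ∀ x ∈ I, a * x ∈ I
  mr : ∀ a ∈ Δ, ∀ x ∈ I, x * a ∈ I
  nb : ∃ x ∈ I, x ≠ 0

/-- Nonzero prime two-sided ideals. -/
structure PrI {R D : Type*} [CommRing R] [DivisionRing D] [Algebra R D]
    (Δ : Subalgebra R D) (I : Submodule R D) : Prop extends TS Δ I where
  one : (1 : D) ∉ I
  pr : ∀ a ∈ Δ, ∀ b ∈ Δ, (∀ r ∈ Δ, a * r * b ∈ I) → a ∈ I ∨ b ∈ I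

section
variable {R D : Type*} [CommRing R] [DivisionRing D] [Algebra R D] {Δ : Subalgebra R D}

theorem GoodOrd.fg_of_le (h : GoodOrd R D Δ) {I : Submodule R D}
    (hI : I ≤ Subalgebra.toSubmodule Δ) : I.FG := by
  have := h.noeth
  have : IsNoetherian R (Subalgebra.toSubmodule Δ) := isNoetherian_of_fg_of_noetherian _ h.fg
  exact (isNoetherian_submodule.1 this) I hI

/-- Noetherian induction for submodules of the order. -/
theorem GoodOrd.induct (h : GoodOrd R D Δ) (C : Submodule R D → Prop)
    (ih : ∀ I, I ≤ Subalgebra.toSubmodule Δ →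
      (∀ J, J ≤ Subalgebra.toSubmodule Δ → I < J → C J) → C I) :
    ∀ I, I ≤ Subalgebra.toSubmodule Δ → C I := by
  have := h.noeth
  have : IsNoetherian R (Subalgebra.toSubmodule Δ) := isNoetherian_of_fg_of_noetherian _ h.fg
  have wf : WellFoundedGT (Set.Iic (Subalgebra.toSubmodule Δ)) :=
    (Submodule.mapIic (Subalgebra.toSubmodule Δ)).symm.toOrderEmbedding.wellFoundedGT
  intro I hI
  have key : ∀ J : Set.Iic (Subalgebra.toSubmodule Δ), C J.1 := by
    intro J
    induction J using wf.wf.induction with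
    | _ J hJ => exact ih J.1 J.2 (fun K hK hlt => hJ ⟨K, hK⟩ hlt)
  exact key ⟨I, hI⟩

theorem GoodOrd.exists_scalar (h : GoodOrd R D Δ) {M : Submodule R D}
    (ml : ∀ a ∈ Δ, ∀ x ∈ M, a * x ∈ M) (nb : ∃ x ∈ M, x ≠ 0) :
    ∃ r : R, r ≠ 0 ∧ algebraMap R D r ∈ M := by
  obtain ⟨x, hx, hx0⟩ := nb
  obtain ⟨r, hr, hrx⟩ := h.den x⁻¹
  refine ⟨r, hr, ?_⟩
  have := ml _ hrx x hx
  rwa [Algebra.smul_def, mul_assoc, inv_mul_cancel₀ hx0, mul_one] at this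

theorem TS.sup {I : Submodule R D} (hI : TS Δ I) {J : Submodule R D}
    (hJ : J ≤ Subalgebra.toSubmodule Δ) (hl : ∀ a ∈ Δ, ∀ x ∈ J, a * x ∈ J)
    (hr : ∀ a ∈ Δ, ∀ x ∈ J, x * a ∈ J) : TS Δ (I ⊔ J) := by
  refine ⟨?_, ?_, ?_, ?_⟩
  · intro x hx
    have : I ⊔ J ≤ Subalgebra.toSubmodule Δ := sup_le (fun y hy => hI.le y hy) hJ
    exact this hx
  · intro a ha x hx
    obtain ⟨y, hy, z, hz, rfl⟩ := Submodule.mem_sup.1 hx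
    rw [mul_add]
    exact Submodule.add_mem_sup (hI.ml a ha y hy) (hl a ha z hz)
  · intro a ha x hx
    obtain ⟨y, hy, z, hz, rfl⟩ := Submodule.mem_sup.1 hx
    rw [add_mul]
    exact Submodule.add_mem_sup (hI.mr a ha y hy) (hr a ha z hz)
  · obtain ⟨x, hx, h0⟩ := hI.nb
    exact ⟨x, Submodule.mem_sup_left hx, h0⟩

/-- The two-sided ideal generated by an element. -/
def gen2 (Δ : Subalgebra R D) (a : D) : Submodule R D :=
  Subalgebra.toSubmodule Δ * Submodule.span R {a} * Subalgebra.toSubmodule Δ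

theorem gen2_le {a : D} {I : Submodule R D}
    (h : ∀ r ∈ Δ, ∀ s ∈ Δ, r * a * s ∈ I) : gen2 Δ a ≤ I := by
  unfold gen2
  rw [Submodule.mul_le]
  intro m hm s hs
  obtain ⟨r, hr, rfl⟩ := Submodule.mem_mul_span_singleton.1 hm
  exact h r hr s hs

theorem mem_gen2 {a r s : D} (hr : r ∈ Δ) (hs : s ∈ Δ) : r * a * s ∈ gen2 Δ a :=
  Submodule.mul_mem_mul (Submodule.mul_mem_mul hr (Submodule.mem_span_singleton_self a)) hs

theorem self_mem_gen2 {a : D} : a ∈ gen2 Δ a := by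
  simpa using mem_gen2 (a := a) (one_mem Δ) (one_mem Δ)

theorem gen2_ml {a : D} : ∀ r ∈ Δ, ∀ x ∈ gen2 Δ a, r * x ∈ gen2 Δ a := by
  intro r hr x hx
  have : gen2 Δ a ≤ (gen2 Δ a).comap (LinearMap.mulLeft R r) := by
    apply gen2_le
    intro p hp q hq
    simp only [Submodule.mem_comap, LinearMap.mulLeft_apply]
    rw [← mul_assoc, ← mul_assoc]
    exact mem_gen2 (mul_mem hr hp) hq
  exact this hx

theorem gen2_mr {a : D} : ∀ r ∈ Δ, ∀ x ∈ gen2 Δ a, x * r ∈ gen2 Δ a := by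
  intro r hr x hx
  have : gen2 Δ a ≤ (gen2 Δ a).comap (LinearMap.mulRight R r) := by
    apply gen2_le
    intro p hp q hq
    simp only [Submodule.mem_comap, LinearMap.mulRight_apply]
    rw [mul_assoc]
    exact mem_gen2 hp (mul_mem hq hr)
  exact this hx

theorem TS.sup_gen2 {I : Submodule R D} (hI : TS Δ I) {a : D} (ha : a ∈ Δ) :
    TS Δ (I ⊔ gen2 Δ a) :=
  hI.sup (gen2_le fun _ hr _ hs => Subalgebra.mul_mem Δ (Subalgebra.mul_mem Δ hr ha) hs) gen2_ml gen2_mr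

theorem lt_sup_gen2 {I : Submodule R D} {a : D} (ha : a ∉ I) : I < I ⊔ gen2 Δ a := by
  refine lt_of_le_of_ne le_sup_left fun h => ha ?_
  rw [h]; exact Submodule.mem_sup_right self_mem_gen2

/-- Every nonzero two-sided ideal contains a product of primes. -/
theorem GoodOrd.exists_prod (h : GoodOrd R D Δ) (I : Submodule R D) (hI : TS Δ I) :
    ∃ l : List (Submodule R D), (∀ P ∈ l, PrI Δ P) ∧ l.prod ≤ I := by
  have key : ∀ I, I ≤ Subalgebra.toSubmodule Δ → (TS Δ I →
      ∃ l : List (Submodule R D), (∀ P ∈ l, PrI Δ P) ∧ l.prod ≤ I) := by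
    apply h.induct
    intro I _ ih hI
    by_cases h1 : (1 : D) ∈ I
    · exact ⟨[], by simp, by simpa using h1⟩
    by_cases hp : ∀ a ∈ Δ, ∀ b ∈ Δ, (∀ r ∈ Δ, a * r * b ∈ I) → a ∈ I ∨ b ∈ I
    · refine ⟨[I], ?_, by simp⟩
      intro P hP
      rw [List.mem_singleton] at hP
      subst hP
      exact ⟨hI, h1, hp⟩
    push Not at hp
    obtain ⟨a, ha, b, hb, hab, haI, hbI⟩ := hp
    obtain ⟨l1, hl1, hp1⟩ := ih _ (fun x hx => (hI.sup_gen2 ha).le x hx) (lt_sup_gen2 haI)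
      (hI.sup_gen2 ha)
    obtain ⟨l2, hl2, hp2⟩ := ih _ (fun x hx => (hI.sup_gen2 hb).le x hx) (lt_sup_gen2 hbI)
      (hI.sup_gen2 hb)
    refine ⟨l1 ++ l2, ?_, ?_⟩
    · intro P hP
      rcases List.mem_append.1 hP with h | h
      · exact hl1 P h
      · exact hl2 P h
    · rw [List.prod_append]
      refine (mul_le_mul' hp1 hp2).trans ?_
      rw [Submodule.mul_le]
      intro x hx y hy
      obtain ⟨x1, hx1, x2, hx2, rfl⟩ := Submodule.mem_sup.1 hx
      rw [add_mul]
      refine I.add_mem (hI.mr _ ((hI.sup_gen2 hb).le y hy) _ hx1) ?_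
      obtain ⟨y1, hy1, y2, hy2, rfl⟩ := Submodule.mem_sup.1 hy
      rw [mul_add]
      have hg : ∀ c ∈ Δ, gen2 Δ c ≤ Subalgebra.toSubmodule Δ := fun c hc =>
        gen2_le fun _ hr _ hs => Subalgebra.mul_mem Δ (Subalgebra.mul_mem Δ hr hc) hs
      refine I.add_mem (hI.ml _ (hg a ha hx2) _ hy1) ?_
      have e1 : gen2 Δ b ≤ I.comap (LinearMap.mulLeft R x2) := by
        apply gen2_le
        intro r hr s hs
        have e2 : gen2 Δ a ≤ I.comap (LinearMap.mulRight R (r * b * s)) := by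
          apply gen2_le
          intro r' hr' s' hs'
          simp only [Submodule.mem_comap, LinearMap.mulRight_apply]
          have : r' * a * s' * (r * b * s) = r' * (a * (s' * r) * b) * s := by
            simp only [mul_assoc]
          rw [this]
          exact hI.mr _ hs _ (hI.ml _ hr' _ (hab _ (mul_mem hs' hr)))
        exact e2 hx2
      exact e1 hy2
  exact key I (fun x hx => hI.le x hx) hI

/-- Every proper two-sided ideal lies in a prime. -/
theorem GoodOrd.exists_prime (h : GoodOrd R D Δ) (I : Submodule R D) (hI : TS Δ I)
    (h1 : (1 : D) ∉ I) : ∃ P, PrI Δ P ∧ I ≤ P := by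
  have key : ∀ I, I ≤ Subalgebra.toSubmodule Δ → (TS Δ I → (1 : D) ∉ I →
      ∃ P, PrI Δ P ∧ I ≤ P) := by
    apply h.induct
    intro I _ ih hI h1
    by_cases hm : ∃ a ∈ Δ, a ∉ I ∧ (1 : D) ∉ I ⊔ gen2 Δ a
    · obtain ⟨a, ha, haI, h1a⟩ := hm
      obtain ⟨P, hP, hle⟩ := ih _ (fun x hx => (hI.sup_gen2 ha).le x hx) (lt_sup_gen2 haI)
        (hI.sup_gen2 ha) h1a
      exact ⟨P, hP, le_sup_left.trans hle⟩
    push Not at hm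
    refine ⟨I, ⟨hI, h1, ?_⟩, le_rfl⟩
    intro a ha b hb hab
    by_cases haI : a ∈ I
    · exact Or.inl haI
    right
    obtain ⟨x, hx, y, hy, hxy⟩ := Submodule.mem_sup.1 (hm a ha haI)
    have : b = x * b + y * b := by rw [← add_mul, hxy, one_mul]
    rw [this]
    refine I.add_mem (hI.mr _ hb _ hx) ?_
    have e2 : gen2 Δ a ≤ I.comap (LinearMap.mulRight R b) := by
      apply gen2_le
      intro r hr s hs
      simp only [Submodule.mem_comap, LinearMap.mulRight_apply]
      have : r * a * s * b = r * (a * s * b) := by simp only [mul_assoc]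
      rw [this]
      exact hI.ml _ hr _ (hab _ hs)
    exact e2 hy
  exact key I (fun x hx => hI.le x hx) hI h1

/-- Quotients by primes are semisimple (expressed by idempotents). -/
theorem GoodOrd.prime_idem (h : GoodOrd R D Δ) {P : Submodule R D} (hP : PrI Δ P)
    (L : Submodule R D) (hL : L ≤ Subalgebra.toSubmodule Δ)
    (ml : ∀ a ∈ Δ, ∀ x ∈ L, a * x ∈ L) :
    ∃ e ∈ L, ∀ a ∈ L, a * (1 - e) ∈ P := by
  let I : Ideal Δ :=
    { carrier := {x | (x : D) ∈ P}
      add_mem' := fun ha hb => P.add_mem ha hb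
      zero_mem' := P.zero_mem
      smul_mem' := fun c x hx => hP.ml c c.2 x hx }
  have memI : ∀ x : Δ, x ∈ I ↔ (x : D) ∈ P := fun x => Iff.rfl
  have : I.IsTwoSided := ⟨fun {a} b ha => hP.mr b b.2 a ha⟩
  obtain ⟨r, hr, hrP⟩ := h.exists_scalar hP.ml hP.nb
  have hfin : Finite (Δ ⧸ I) := by
    have := h.fin r hr
    have hfg : Module.Finite R Δ := Module.Finite.iff_fg.2 h.fg
    have htor : Module.IsTorsionBy R (Δ ⧸ I.restrictScalars R) r := by
      intro x
      obtain ⟨x, rfl⟩ := Submodule.Quotient.mk_surjective _ x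
      rw [← Submodule.Quotient.mk_smul, Submodule.Quotient.mk_eq_zero]
      change ((r • x : Δ) : D) ∈ P
      have : ((r • x : Δ) : D) = algebraMap R D r * x := by
        simp [Algebra.smul_def]
      rw [this]
      exact hP.mr x x.2 _ hrP
    let _ := htor.module
    have hst : IsScalarTower R (R ⧸ Ideal.span {r}) (Δ ⧸ I.restrictScalars R) :=
      Module.IsTorsionBySet.isScalarTower _
    have : Module.Finite (R ⧸ Ideal.span {r}) (Δ ⧸ I.restrictScalars R) :=
      Module.Finite.of_restrictScalars_finite R _ _
    have : Finite (Δ ⧸ I.restrictScalars R) := Module.finite_of_finite (R ⧸ Ideal.span {r})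
    let f : (Δ ⧸ I.restrictScalars R) → (Δ ⧸ I) :=
      Quotient.lift (fun x => Ideal.Quotient.mk I x) (by
        intro a b hab
        rw [Ideal.Quotient.eq]
        exact (Submodule.quotientRel_def _).1 hab)
    refine Finite.of_surjective f ?_
    intro y
    obtain ⟨y, rfl⟩ := Ideal.Quotient.mk_surjective y
    exact ⟨Submodule.Quotient.mk y, rfl⟩
  have hart : IsArtinianRing (Δ ⧸ I) := isArtinian_of_finite
  let L' : Ideal Δ :=
    { carrier := {x | (x : D) ∈ L}
      add_mem' := fun ha hb => L.add_mem ha hb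
      zero_mem' := L.zero_mem
      smul_mem' := fun c x hx => ml c c.2 x hx }
  have hp : ∀ a b : Δ ⧸ I, (∀ r, a * r * b = 0) → a = 0 ∨ b = 0 := by
    intro a b hab
    obtain ⟨a, rfl⟩ := Ideal.Quotient.mk_surjective a
    obtain ⟨b, rfl⟩ := Ideal.Quotient.mk_surjective b
    rw [Ideal.Quotient.eq_zero_iff_mem, Ideal.Quotient.eq_zero_iff_mem, memI, memI]
    apply hP.pr a a.2 b b.2
    intro r hr
    have := hab (Ideal.Quotient.mk I ⟨r, hr⟩)
    rw [← map_mul, ← map_mul, Ideal.Quotient.eq_zero_iff_mem, memI] at this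
    exact this
  obtain ⟨e, he, hea⟩ := primeArtin_idem hp (L'.map (Ideal.Quotient.mk I))
  obtain ⟨e, heL, rfl⟩ := (Ideal.mem_map_iff_of_surjective _ Ideal.Quotient.mk_surjective).1 he
  refine ⟨e, heL, fun a ha => ?_⟩
  have := hea (Ideal.Quotient.mk I ⟨a, hL ha⟩) (Ideal.mem_map_of_mem _ ha)
  rw [← map_one (Ideal.Quotient.mk I), ← map_sub, ← map_mul, Ideal.Quotient.eq_zero_iff_mem,
    memI] at this
  exact this
end

section
variable {R D : Type*} [CommRing R] [DivisionRing D] [Algebra R D] {Δ : Subalgebra R D}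

theorem one_mem_nilprod : (1 : D) ∈ ([] : List (Submodule R D)).prod := by
  rw [List.prod_nil]; exact Submodule.one_le.1 le_rfl

/-- The dual `{x | M x ⊆ Δ}`. -/
def dualL (Δ : Subalgebra R D) (M : Submodule R D) : Submodule R D where
  carrier := {x | ∀ m ∈ M, m * x ∈ Δ}
  add_mem' := fun ha hb m hm => by rw [mul_add]; exact add_mem (ha m hm) (hb m hm)
  zero_mem' := fun m _ => by rw [mul_zero]; exact zero_mem _
  smul_mem' := fun c x hx m hm => by
    rw [mul_smul_comm]; exact Subalgebra.smul_mem _ (hx m hm) c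

theorem mem_dualL {M : Submodule R D} {x : D} : x ∈ dualL Δ M ↔ ∀ m ∈ M, m * x ∈ Δ := Iff.rfl

theorem GoodOrd.prime_max (h : GoodOrd R D Δ) {P Q : Submodule R D} (hP : PrI Δ P)
    (hQ : PrI Δ Q) (hQP : Q ≤ P) : Q = P := by
  refine le_antisymm hQP fun a ha => ?_
  obtain ⟨e, he, hea⟩ := h.prime_idem hQ P (fun x hx => hP.le x hx) hP.ml
  rcases hQ.pr a (hP.le a ha) (1 - e) (sub_mem (one_mem _) (hP.le e he))
    (fun r hr => hea _ (hP.mr r hr a ha)) with h1 | h1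
  · exact h1
  · exact absurd (by simpa using P.add_mem (hQP h1) he) hP.one

theorem prod_le_ord (l : List (Submodule R D)) (hl : ∀ P ∈ l, PrI Δ P) :
    l.prod ≤ Subalgebra.toSubmodule Δ := by
  induction l with
  | nil => simp
  | cons Q t ih =>
    rw [List.prod_cons, Submodule.mul_le]
    intro q hq b hb
    exact Subalgebra.mul_mem Δ ((hl Q (by simp)).le q hq)
      (ih (fun P hP => hl P (by simp [hP])) hb)

theorem prod_ne (l : List (Submodule R D)) (hl : ∀ P ∈ l, PrI Δ P) :
    ∃ x ∈ l.prod, x ≠ 0 := by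
  induction l with
  | nil => exact ⟨1, one_mem_nilprod, one_ne_zero⟩
  | cons Q t ih =>
    obtain ⟨x, hx, hx0⟩ := ih (fun P hP => hl P (by simp [hP]))
    obtain ⟨q, hq, hq0⟩ := (hl Q (by simp)).nb
    exact ⟨q * x, by rw [List.prod_cons]; exact Submodule.mul_mem_mul hq hx, mul_ne_zero hq0 hx0⟩

theorem prime_list {P : Submodule R D} (hP : PrI Δ P) (l : List (Submodule R D))
    (hl : ∀ P ∈ l, PrI Δ P) (hle : l.prod ≤ P) : ∃ Q ∈ l, Q ≤ P := by
  induction l with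
  | nil =>
    exact absurd (hle (one_mem_nilprod)) hP.one
  | cons Q t ih =>
    by_cases hQ : Q ≤ P
    · exact ⟨Q, by simp, hQ⟩
    obtain ⟨q, hq, hqP⟩ := SetLike.not_le_iff_exists.1 hQ
    have hQ' := hl Q (by simp)
    have ht : ∀ P ∈ t, PrI Δ P := fun P hP => hl P (by simp [hP])
    obtain ⟨Q', hQ', hle2⟩ := ih ht (by
      intro b hb
      rcases hP.pr q (hQ'.le q hq) b (prod_le_ord t ht hb) (fun r hr => by
        apply hle
        rw [List.prod_cons]
        exact Submodule.mul_mem_mul (hQ'.mr r hr q hq) hb) with h1 | h1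
      · exact absurd h1 hqP
      · exact h1)
    exact ⟨Q', by simp [hQ'], hle2⟩

/-- A prime has dual strictly larger than the order. -/
theorem GoodOrd.key_prime (h : GoodOrd R D Δ) {P : Submodule R D} (hP : PrI Δ P) :
    ∃ x ∈ dualL Δ P, x ∉ Δ := by
  by_contra hcon
  push Not at hcon
  obtain ⟨r, hr, hrP⟩ := h.exists_scalar hP.ml hP.nb
  have hr0 : algebraMap R D r ≠ 0 := fun h0 => hr (h.inj r h0)
  -- the ideal `r Δ`
  let A : Submodule R D := (Subalgebra.toSubmodule Δ).map (LinearMap.mulLeft R (algebraMap R D r))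
  have memA : ∀ x, x ∈ A ↔ (algebraMap R D r)⁻¹ * x ∈ Δ := by
    intro x
    constructor
    · rintro ⟨y, hy, rfl⟩
      rw [LinearMap.mulLeft_apply, inv_mul_cancel_left₀ hr0]; exact hy
    · intro hx
      exact ⟨_, hx, by rw [LinearMap.mulLeft_apply, mul_inv_cancel_left₀ hr0]⟩
  have hcomm : ∀ x : D, (algebraMap R D r)⁻¹ * x = x * (algebraMap R D r)⁻¹ := fun x =>
    (Commute.inv_left₀ (show Commute (algebraMap R D r) x from Algebra.commutes r x)).eq
  have hA : TS Δ A := by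
    refine ⟨?_, ?_, ?_, ⟨algebraMap R D r, ?_, hr0⟩⟩
    · rintro x ⟨y, hy, rfl⟩
      exact mul_mem (Subalgebra.algebraMap_mem _ _) hy
    · intro a ha x hx
      rw [memA] at hx ⊢
      rw [← mul_assoc, hcomm, mul_assoc]
      exact mul_mem ha hx
    · intro a ha x hx
      rw [memA] at hx ⊢
      rw [← mul_assoc]
      exact mul_mem hx ha
    · rw [memA, inv_mul_cancel₀ hr0]; exact one_mem _
  have hAP : A ≤ P := by
    rintro x ⟨y, hy, rfl⟩
    exact hP.mr y hy _ hrP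
  have key : ∀ n : ℕ, ∀ l : List (Submodule R D), l.length = n → (∀ P ∈ l, PrI Δ P) →
      l.prod ≤ A → False := by
    intro n
    induction n with
    | zero =>
      intro l hn hl hle
      rw [List.length_eq_zero_iff] at hn
      subst hn
      exact hP.one (hAP (hle (one_mem_nilprod)))
    | succ n ih =>
      intro l hn hl hle
      obtain ⟨Q, hQl, hQP⟩ := prime_list hP l hl (hle.trans hAP)
      rw [h.prime_max hP (hl Q hQl) hQP] at hQl
      obtain ⟨s, t, rfl⟩ := List.append_of_mem hQl
      have hs : ∀ P ∈ s, PrI Δ P := fun P hP => hl P (by simp [hP])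
      have ht : ∀ P ∈ t, PrI Δ P := fun P hP => hl P (by simp [hP])
      apply ih (t ++ s) (by simp at hn ⊢; omega)
      · intro P hP
        rcases List.mem_append.1 hP with h | h
        · exact ht P h
        · exact hs P h
      rw [List.prod_append, Submodule.mul_le]
      intro c hc b hb
      rw [memA, ← mul_assoc, hcomm]
      apply hcon
      intro p hp
      -- use the right order of the two-sided ideal generated by s
      set O := Subalgebra.toSubmodule Δ with hO
      have h1O : (1 : D) ∈ O := one_mem Δ
      have hOO : O * O = O := Subalgebra.isIdempotentElem_toSubmodule Δ
      have hB' : O * s.prod * O ≤ O := by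
        calc O * s.prod * O ≤ O * O * O := by gcongr; exact prod_le_ord s hs
          _ = O := by rw [hOO, hOO]
      have hbB : b ∈ O * s.prod * O := by
        have := Submodule.mul_mem_mul (Submodule.mul_mem_mul h1O hb)
          h1O
        simpa using this
      refine h.rt (O * s.prod * O) (h.fg_of_le hB') ?_ ?_ _ ?_
      · obtain ⟨x, hx, hx0⟩ := prod_ne s hs
        refine (Submodule.ne_bot_iff _).2 ⟨x, ?_, hx0⟩
        have := Submodule.mul_mem_mul (Submodule.mul_mem_mul h1O hx)
          h1O
        simpa using this
      · rw [mul_assoc, hOO]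
      · intro y hy
        have e1 : y * (p * c) ∈ A := by
          have hle' : O * s.prod * O * (P * t.prod) ≤ A := by
            have hOP : O * P ≤ P := Submodule.mul_le.2 hP.ml
            calc O * s.prod * O * (P * t.prod) = O * s.prod * (O * P) * t.prod := by
                  simp only [mul_assoc]
              _ ≤ O * s.prod * P * t.prod := by gcongr
              _ = O * (s ++ P :: t).prod := by
                  rw [List.prod_append, List.prod_cons]; simp only [mul_assoc]
              _ ≤ O * A := by gcongr
              _ ≤ A := Submodule.mul_le.2 hA.ml
          exact hle' (Submodule.mul_mem_mul hy (Submodule.mul_mem_mul hp hc))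
        rw [memA, hcomm] at e1
        have e2 : y * (p * (c * (algebraMap R D r)⁻¹ * b))
            = y * (p * c) * (algebraMap R D r)⁻¹ * b := by simp only [mul_assoc]
        rw [e2]
        have : O * (O * s.prod * O) = O * s.prod * O := by
          rw [← mul_assoc, ← mul_assoc, hOO]
        rw [← this]
        exact Submodule.mul_mem_mul e1 hbB
  obtain ⟨l, hl, hle⟩ := h.exists_prod A hA
  exact key _ l rfl hl hle

/-- A proper two-sided ideal has dual strictly larger than the order. -/
theorem GoodOrd.key_ts (h : GoodOrd R D Δ) {J : Submodule R D} (hJ : TS Δ J)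
    (hd : ∀ x ∈ dualL Δ J, x ∈ Δ) : (1 : D) ∈ J := by
  by_contra h1
  obtain ⟨P, hP, hle⟩ := h.exists_prime J hJ h1
  obtain ⟨x, hx, hxO⟩ := h.key_prime hP
  exact hxO (hd x fun m hm => hx m (hle hm))

theorem GoodOrd.exists_den (h : GoodOrd R D Δ) {M : Submodule R D} (hfg : M.FG) :
    ∃ r : R, r ≠ 0 ∧ ∀ m ∈ M, r • m ∈ Δ := by
  obtain ⟨s, rfl⟩ := hfg
  classical
  induction s using Finset.induction_on with
  | empty =>
    obtain ⟨r, hr, _⟩ := h.den 0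
    exact ⟨r, hr, fun m hm => by simp at hm; simp [hm]⟩
  | insert a s _ ih =>
    obtain ⟨r, hr, hrs⟩ := ih
    obtain ⟨t, ht, hta⟩ := h.den a
    refine ⟨r * t, ?_, ?_⟩
    · intro h0
      have h0' := congrArg (algebraMap R D) h0
      rw [map_mul, map_zero, mul_eq_zero] at h0'
      rcases h0' with h0' | h0'
      · exact hr (h.inj _ h0')
      · exact ht (h.inj _ h0')
    · intro m hm
      rw [Finset.coe_insert, Submodule.mem_span_insert] at hm
      obtain ⟨c, z, hz, rfl⟩ := hm
      have : (r * t) • (c • a + z) = (r * c) • (t • a) + t • (r • z) := by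
        rw [smul_add, smul_smul, smul_smul, smul_smul]; congr 2 <;> ring
      rw [this]
      exact add_mem (Subalgebra.smul_mem _ hta _) (Subalgebra.smul_mem _ (hrs z hz) _)

/-- `M M* ∋ 1` for every left lattice. -/
theorem GoodOrd.mul_star (h : GoodOrd R D Δ) {M : Submodule R D} (hfg : M.FG)
    (ml : ∀ a ∈ Δ, ∀ x ∈ M, a * x ∈ M) (nb : ∃ x ∈ M, x ≠ 0) :
    (1 : D) ∈ M * dualL Δ M := by
  have hnb := h.exists_den hfg
  obtain ⟨r, hr, hrM⟩ := hnb
  have hr0 : algebraMap R D r ≠ 0 := fun h0 => hr (h.inj r h0)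
  have hrs : algebraMap R D r ∈ dualL Δ M := by
    intro m hm
    have := hrM m hm
    rwa [Algebra.smul_def, Algebra.commutes] at this
  have sr : ∀ a ∈ Δ, ∀ x ∈ dualL Δ M, x * a ∈ dualL Δ M := by
    intro a ha x hx m hm
    rw [← mul_assoc]; exact mul_mem (hx m hm) ha
  have hJ : TS Δ (M * dualL Δ M) := by
    refine ⟨?_, ?_, ?_, ?_⟩
    · have : M * dualL Δ M ≤ Subalgebra.toSubmodule Δ :=
        Submodule.mul_le.2 fun m hm x hx => hx m hm
      exact fun x hx => this hx
    · intro a ha x hx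
      have : Subalgebra.toSubmodule Δ * (M * dualL Δ M) ≤ M * dualL Δ M := by
        rw [← mul_assoc]
        exact mul_le_mul' (Submodule.mul_le.2 ml) le_rfl
      exact this (Submodule.mul_mem_mul ha hx)
    · intro a ha x hx
      have : (M * dualL Δ M) * Subalgebra.toSubmodule Δ ≤ M * dualL Δ M := by
        rw [mul_assoc]
        exact mul_le_mul' le_rfl (Submodule.mul_le.2 fun x hx a ha => sr a ha x hx)
      exact this (Submodule.mul_mem_mul hx ha)
    · obtain ⟨x, hx, hx0⟩ := nb
      exact ⟨_, Submodule.mul_mem_mul hx hrs, mul_ne_zero hx0 hr0⟩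
  apply h.key_ts hJ
  intro x hx
  refine h.rt _ (h.fg_of_le fun y hy => hJ.le y hy) ?_ ?_ x ?_
  · obtain ⟨y, hy⟩ := hJ.nb
    exact (Submodule.ne_bot_iff _).2 ⟨y, hy⟩
  · exact Submodule.mul_le.2 fun y hy a ha => hJ.mr a ha y hy
  · intro y hy
    induction hy using Submodule.mul_induction_on' with
    | mem_mul_mem m hm n hn =>
      rw [mul_assoc]
      refine Submodule.mul_mem_mul hm fun m' hm' => ?_
      rw [← mul_assoc]
      exact hx _ (Submodule.mul_mem_mul hm' hn)
    | add y _ z _ hy hz => rw [add_mul]; exact Submodule.add_mem _ hy hz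

/-- `P* P ∋ 1` for two-sided ideals. -/
theorem GoodOrd.star_mul_ts (h : GoodOrd R D Δ) {P : Submodule R D} (hP : TS Δ P) :
    (1 : D) ∈ dualL Δ P * P := by
  have hfg : P.FG := h.fg_of_le fun y hy => hP.le y hy
  have hnb : P ≠ ⊥ := by
    obtain ⟨y, hy⟩ := hP.nb
    exact (Submodule.ne_bot_iff _).2 ⟨y, hy⟩
  have hrt : ∀ x, (∀ b ∈ P, b * x ∈ P) → x ∈ Δ :=
    h.rt P hfg hnb (Submodule.mul_le.2 fun y hy a ha => hP.mr a ha y hy)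
  have hPP := h.mul_star hfg hP.ml hP.nb
  have sl : ∀ a ∈ Δ, ∀ x ∈ dualL Δ P, a * x ∈ dualL Δ P := by
    intro a ha x hx m hm
    rw [← mul_assoc]; exact hx _ (hP.mr a ha m hm)
  have hT : TS Δ (dualL Δ P * P) := by
    refine ⟨?_, ?_, ?_, ?_⟩
    · have : dualL Δ P * P ≤ Subalgebra.toSubmodule Δ :=
        Submodule.mul_le.2 fun x hx p hp => hrt _ fun b hb => by
          rw [← mul_assoc]; exact hP.ml _ (hx b hb) p hp
      exact fun x hx => this hx
    · intro a ha x hx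
      have : Subalgebra.toSubmodule Δ * (dualL Δ P * P) ≤ dualL Δ P * P := by
        rw [← mul_assoc]
        exact mul_le_mul' (Submodule.mul_le.2 sl) le_rfl
      exact this (Submodule.mul_mem_mul ha hx)
    · intro a ha x hx
      have : (dualL Δ P * P) * Subalgebra.toSubmodule Δ ≤ dualL Δ P * P := by
        rw [mul_assoc]
        exact mul_le_mul' le_rfl (Submodule.mul_le.2 fun x hx a ha => hP.mr a ha x hx)
      exact this (Submodule.mul_mem_mul hx ha)
    · obtain ⟨x, hx, hx0⟩ := hP.nb
      refine ⟨1 * x, Submodule.mul_mem_mul (fun m hm => ?_) hx, by simpa using hx0⟩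
      rw [mul_one]; exact hP.le m hm
  apply h.key_ts hT
  intro y hy
  apply hrt
  intro p hp
  have gen : ∀ z ∈ P * dualL Δ P, z * (p * y) ∈ P := by
    intro z hz
    induction hz using Submodule.mul_induction_on' with
    | mem_mul_mem m hm n hn =>
      have : m * n * (p * y) = m * (n * p * y) := by simp only [mul_assoc]
      rw [this]
      exact hP.mr _ (hy _ (Submodule.mul_mem_mul hn hp)) m hm
    | add y _ z _ hy hz => rw [add_mul]; exact Submodule.add_mem _ hy hz
  simpa using gen 1 hPP
end

section
variable {R D : Type*} [CommRing R] [DivisionRing D] [Algebra R D] {Δ : Subalgebra R D}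

theorem find_prime {M : Submodule R D} (l : List (Submodule R D)) (hl : ∀ P ∈ l, PrI Δ P)
    (k : D) (hk : k ∈ Δ) (hkM : k ∉ M) (hb : ∀ b ∈ l.prod, b * k ∈ M) :
    ∃ P ∈ l, ∃ k ∈ Δ, k ∉ M ∧ ∀ p ∈ P, p * k ∈ M := by
  induction l with
  | nil => exact absurd (by simpa using hb 1 one_mem_nilprod) hkM
  | cons Q t ih =>
    have ht : ∀ P ∈ t, PrI Δ P := fun P hP => hl P (by simp [hP])
    by_cases h1 : ∀ b ∈ t.prod, b * k ∈ M
    · obtain ⟨P, hP, h2⟩ := ih ht h1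
      exact ⟨P, by simp [hP], h2⟩
    push Not at h1
    obtain ⟨b, hbt, hbM⟩ := h1
    refine ⟨Q, by simp, b * k, mul_mem (prod_le_ord t ht hbt) hk, hbM, fun q hq => ?_⟩
    rw [← mul_assoc]
    apply hb
    rw [List.prod_cons]
    exact Submodule.mul_mem_mul hq hbt

/-- Maximal orders are hereditary: `M* M ∋ 1` for integral left ideals. -/
theorem GoodOrd.hered (h : GoodOrd R D Δ) (M : Submodule R D)
    (hM : M ≤ Subalgebra.toSubmodule Δ)
    (ml : ∀ a ∈ Δ, ∀ x ∈ M, a * x ∈ M) (nb : ∃ x ∈ M, x ≠ 0) :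
    (1 : D) ∈ dualL Δ M * M := by
  have main : ∀ M, M ≤ Subalgebra.toSubmodule Δ → ((∀ a ∈ Δ, ∀ x ∈ M, a * x ∈ M) →
      (∃ x ∈ M, x ≠ 0) → (1 : D) ∈ dualL Δ M * M) := by
    apply h.induct
    intro M hM ih ml nb
    by_cases h1 : (1 : D) ∈ M
    · have : (1 : D) * 1 ∈ dualL Δ M * M := by
        refine Submodule.mul_mem_mul (fun m hm => ?_) h1
        rw [mul_one]; exact hM hm
      simpa using this
    obtain ⟨r, hr, hrM⟩ := h.exists_scalar ml nb
    have hr0 : algebraMap R D r ≠ 0 := fun h0 => hr (h.inj r h0)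
    have hA : TS Δ (gen2 Δ (algebraMap R D r)) :=
      ⟨fun x hx => (gen2_le (I := Subalgebra.toSubmodule Δ) fun _ hr _ hs =>
          Subalgebra.mul_mem Δ (Subalgebra.mul_mem Δ hr (Subalgebra.algebraMap_mem _ _)) hs) hx,
        gen2_ml, gen2_mr, ⟨_, self_mem_gen2, hr0⟩⟩
    have hAM : gen2 Δ (algebraMap R D r) ≤ M := by
      apply gen2_le
      intro a ha s hs
      rw [mul_assoc, Algebra.commutes, ← mul_assoc]
      exact ml _ (mul_mem ha hs) _ hrM
    obtain ⟨l, hl, hle⟩ := h.exists_prod _ hA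
    obtain ⟨P, hPl, k, hk, hkM, hPk⟩ := find_prime l hl 1 (one_mem Δ) h1
      (fun b hb => by rw [mul_one]; exact hAM (hle hb))
    have hP := hl P hPl
    let L : Submodule R D :=
      Subalgebra.toSubmodule Δ ⊓ M.comap (LinearMap.mulRight R k)
    have memL : ∀ a, a ∈ L ↔ a ∈ Δ ∧ a * k ∈ M := fun a => Iff.rfl
    obtain ⟨e, heL, he⟩ := h.prime_idem hP L inf_le_left (by
      intro a ha x hx
      rw [memL] at hx ⊢
      refine ⟨mul_mem ha hx.1, ?_⟩
      rw [mul_assoc]; exact ml a ha _ hx.2)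
    let K : Submodule R D := M ⊔ Subalgebra.toSubmodule Δ * Submodule.span R {k}
    have hMK : M ≤ K := le_sup_left
    have memK : ∀ v ∈ K, ∃ m ∈ M, ∃ c ∈ Δ, v = m + c * k := by
      intro v hv
      obtain ⟨m, hm, y, hy, rfl⟩ := Submodule.mem_sup.1 hv
      obtain ⟨c, hc, rfl⟩ := Submodule.mem_mul_span_singleton.1 hy
      exact ⟨m, hm, c, hc, rfl⟩
    have hkK : ∀ c ∈ Δ, c * k ∈ K := fun c hc => Submodule.mem_sup_right
      (Submodule.mem_mul_span_singleton.2 ⟨c, hc, rfl⟩)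
    have hKO : K ≤ Subalgebra.toSubmodule Δ := by
      intro v hv
      obtain ⟨m, hm, c, hc, rfl⟩ := memK v hv
      exact Subalgebra.add_mem Δ (hM hm) (mul_mem hc hk)
    have hKl : ∀ a ∈ Δ, ∀ x ∈ K, a * x ∈ K := by
      intro a ha v hv
      obtain ⟨m, hm, c, hc, rfl⟩ := memK v hv
      rw [mul_add, ← mul_assoc]
      exact K.add_mem (hMK (ml a ha m hm)) (hkK _ (mul_mem ha hc))
    have hlt : M < K := lt_of_le_of_ne hMK fun heq => hkM (by
      rw [heq]; simpa using hkK 1 (one_mem Δ))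
    have hK1 := ih K hKO hlt hKl (by
      obtain ⟨x, hx, hx0⟩ := nb
      exact ⟨x, hMK hx, hx0⟩)
    have dKM : dualL Δ K ≤ dualL Δ M := fun x hx m hm => hx m (hMK hm)
    have claim : ∀ w ∈ dualL Δ K * K, ∃ z ∈ dualL Δ K, w - z * k ∈ dualL Δ M * M ∧
        ∀ v ∈ K, v * w - v * z * k ∈ M := by
      intro w hw
      induction hw using Submodule.mul_induction_on' with
      | mem_mul_mem x hx y hy =>
        obtain ⟨m, hm, c, hc, rfl⟩ := memK y hy
        refine ⟨x * c, fun v hv => ?_, ?_, fun v hv => ?_⟩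
        · rw [← mul_assoc]; exact mul_mem (hx v hv) hc
        · have : x * (m + c * k) - x * c * k = x * m := by
            rw [mul_add, mul_assoc]; abel
          rw [this]
          exact Submodule.mul_mem_mul (dKM hx) hm
        · have : v * (x * (m + c * k)) - v * (x * c) * k = v * x * m := by
            simp only [mul_add, mul_assoc]; abel
          rw [this]
          exact ml _ (hx v hv) m hm
      | add x _ y _ hx hy =>
        obtain ⟨z, hz, h1, h2⟩ := hx
        obtain ⟨z', hz', h1', h2'⟩ := hy
        refine ⟨z + z', Submodule.add_mem _ hz hz', ?_, fun v hv => ?_⟩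
        · have : x + y - (z + z') * k = (x - z * k) + (y - z' * k) := by
            rw [add_mul]; abel
          rw [this]; exact Submodule.add_mem _ h1 h1'
        · have : v * (x + y) - v * (z + z') * k
              = (v * x - v * z * k) + (v * y - v * z' * k) := by
            simp only [mul_add, add_mul]; abel
          rw [this]; exact Submodule.add_mem _ (h2 v hv) (h2' v hv)
    obtain ⟨z, hz, hz1, hz2⟩ := claim 1 hK1
    have hmL : ∀ m ∈ M, m * z ∈ L := by
      intro m hm
      refine (memL _).2 ⟨hz m (hMK hm), ?_⟩
      have := M.sub_mem hm (hz2 m (hMK hm))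
      simpa using this
    have t1 : z * (e * k) ∈ dualL Δ M * M := Submodule.mul_mem_mul (dKM hz) heL.2
    have t2 : ∀ w ∈ dualL Δ P * P, z * (1 - e) * w * k ∈ dualL Δ M * M := by
      intro w hw
      induction hw using Submodule.mul_induction_on' with
      | mem_mul_mem y hy p hp =>
        have : z * (1 - e) * (y * p) * k = (z * (1 - e) * y) * (p * k) := by
          simp only [mul_assoc]
        rw [this]
        refine Submodule.mul_mem_mul (fun m hm => ?_) (hPk p hp)
        have : m * (z * (1 - e) * y) = (m * z * (1 - e)) * y := by simp only [mul_assoc]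
        rw [this]
        exact hy _ (he _ (hmL m hm))
      | add x _ y _ hx hy =>
        rw [mul_add, add_mul]; exact Submodule.add_mem _ hx hy
    have t3 := t2 1 (h.star_mul_ts hP.toTS)
    have : (1 : D) = (1 - z * k) + (z * (e * k) + z * (1 - e) * 1 * k) := by
      simp only [mul_sub, sub_mul, mul_one, mul_assoc]; abel
    rw [this]
    exact Submodule.add_mem _ hz1 (Submodule.add_mem _ t1 t3)
  exact main M hM ml nb

/-- `M* M ∋ 1` for all left lattices. -/
theorem GoodOrd.star_mul (h : GoodOrd R D Δ) {M : Submodule R D}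
    (ml : ∀ a ∈ Δ, ∀ x ∈ M, a * x ∈ M) (nb : ∃ x ∈ M, x ≠ 0)
    (r : R) (hr : r ≠ 0) (hrM : ∀ m ∈ M, r • m ∈ Δ) :
    (1 : D) ∈ dualL Δ M * M := by
  have hr0 : algebraMap R D r ≠ 0 := fun h0 => hr (h.inj r h0)
  let N : Submodule R D := M.map (LinearMap.mulLeft R (algebraMap R D r))
  have hN := h.hered N
    (by rintro _ ⟨m, hm, rfl⟩
        have := hrM m hm
        rwa [Algebra.smul_def] at this)
    (by rintro a ha _ ⟨m, hm, rfl⟩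
        refine ⟨a * m, ml a ha m hm, ?_⟩
        simp only [LinearMap.mulLeft_apply]
        rw [← mul_assoc, Algebra.commutes, mul_assoc])
    (by obtain ⟨x, hx, hx0⟩ := nb
        exact ⟨_, ⟨x, hx, rfl⟩, mul_ne_zero hr0 hx0⟩)
  have hle : dualL Δ N * N ≤ dualL Δ M * M := by
    rw [Submodule.mul_le]
    rintro y hy _ ⟨m, hm, rfl⟩
    rw [LinearMap.mulLeft_apply, ← mul_assoc]
    refine Submodule.mul_mem_mul (fun m' hm' => ?_) hm
    have := hy _ ⟨m', hm', rfl⟩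
    rw [LinearMap.mulLeft_apply] at this
    rwa [← Algebra.commutes, ← mul_assoc, ← Algebra.commutes]
  exact hle hN
end

section
variable {F D : Type} [Field F] [NumberField F] [DivisionRing D] [Algebra F D]
    [Algebra (𝓞 F) D] [IsScalarTower (𝓞 F) F D]

theorem order_of_le {Δ Λ : Subalgebra (𝓞 F) D} (hΔ : IsOrder F D Δ) (hle : Δ ≤ Λ)
    (hfg : (Subalgebra.toSubmodule Λ).FG) : IsOrder F D Λ := by
  refine ⟨hfg, ?_⟩
  rw [eq_top_iff, ← hΔ.2]
  exact Submodule.span_mono hle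

theorem goodOrd_of_max {Δ : Subalgebra (𝓞 F) D} (hΔ : IsMaximalOrder F D Δ) :
    GoodOrd (𝓞 F) D Δ where
  noeth := inferInstance
  inj := by
    intro r hr
    rw [IsScalarTower.algebraMap_apply (𝓞 F) F D] at hr
    have h1 := (algebraMap F D).injective (hr.trans (map_zero _).symm)
    exact (FaithfulSMul.algebraMap_injective (𝓞 F) F) (h1.trans (map_zero _).symm)
  fg := hΔ.1.1
  den := by
    intro x
    have hx : x ∈ Submodule.span F ((Subalgebra.toSubmodule Δ : Submodule (𝓞 F) D) : Set D) := by
      rw [hΔ.1.2]; trivial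
    induction hx using Submodule.span_induction with
    | mem x hx => exact ⟨1, one_ne_zero, by rw [one_smul]; exact hx⟩
    | zero => exact ⟨1, one_ne_zero, by rw [smul_zero]; exact zero_mem _⟩
    | add x y _ _ hx hy =>
      obtain ⟨r, hr, hrx⟩ := hx
      obtain ⟨s, hs, hsy⟩ := hy
      refine ⟨r * s, mul_ne_zero hr hs, ?_⟩
      have : (r * s) • (x + y) = s • (r • x) + r • (s • y) := by
        rw [smul_add, smul_smul, smul_smul, mul_comm s r]
      rw [this]
      exact add_mem (Subalgebra.smul_mem _ hrx _) (Subalgebra.smul_mem _ hsy _)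
    | smul c x _ hx =>
      obtain ⟨r, hr, hrx⟩ := hx
      obtain ⟨a, b, hb, rfl⟩ := IsFractionRing.div_surjective (A := 𝓞 F) c
      have hb0 : b ≠ 0 := nonZeroDivisors.ne_zero hb
      have hb1 : algebraMap (𝓞 F) F b ≠ 0 := fun h0 =>
        hb0 ((FaithfulSMul.algebraMap_injective (𝓞 F) F) (h0.trans (map_zero _).symm))
      refine ⟨b * r, mul_ne_zero hb0 hr, ?_⟩
      have : (b * r) • ((algebraMap (𝓞 F) F a / algebraMap (𝓞 F) F b) • x) = a • (r • x) := by
        rw [← IsScalarTower.algebraMap_smul F (b * r), ← IsScalarTower.algebraMap_smul F a,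
          ← IsScalarTower.algebraMap_smul F r, smul_smul, smul_smul, map_mul]
        congr 1
        field_simp
      rw [this]
      exact Subalgebra.smul_mem _ hrx _
  fin := by
    intro r hr
    exact Ring.HasFiniteQuotients.finiteQuotient (by simpa using hr)
  rt := by
    intro B hfg hnb hB x hx
    let Λ : Subalgebra (𝓞 F) D :=
      { carrier := {x | ∀ b ∈ B, b * x ∈ B}
        mul_mem' := fun {x y} hx hy b hb => by rw [← mul_assoc]; exact hy _ (hx b hb)
        add_mem' := fun {x y} hx hy b hb => by
          rw [mul_add]; exact B.add_mem (hx b hb) (hy b hb)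
        algebraMap_mem' := fun r b hb => by
          rw [← Algebra.commutes, ← Algebra.smul_def]; exact B.smul_mem r hb }
    obtain ⟨b, hb, hb0⟩ := (Submodule.ne_bot_iff _).1 hnb
    have hle : Δ ≤ Λ := fun a ha b hb => hB (Submodule.mul_mem_mul hb ha)
    have hΛ : (Subalgebra.toSubmodule Λ).FG := by
      refine Submodule.fg_of_fg_map_injective (LinearMap.mulLeft (𝓞 F) b)
        (fun x y hxy => mul_left_cancel₀ hb0 hxy) ?_
      have : IsNoetherian (𝓞 F) B := isNoetherian_of_fg_of_noetherian _ hfg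
      refine isNoetherian_submodule.1 this _ ?_
      rintro _ ⟨y, hy, rfl⟩
      exact hy b hb
    rw [← hΔ.2 Λ (order_of_le hΔ.1 hle hΛ) hle]
    exact hx
  lt := by
    intro B hfg hnb hB x hx
    let Λ : Subalgebra (𝓞 F) D :=
      { carrier := {x | ∀ b ∈ B, x * b ∈ B}
        mul_mem' := fun {x y} hx hy b hb => by rw [mul_assoc]; exact hx _ (hy b hb)
        add_mem' := fun {x y} hx hy b hb => by
          rw [add_mul]; exact B.add_mem (hx b hb) (hy b hb)
        algebraMap_mem' := fun r b hb => by
          rw [← Algebra.smul_def]; exact B.smul_mem r hb }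
    obtain ⟨b, hb, hb0⟩ := (Submodule.ne_bot_iff _).1 hnb
    have hle : Δ ≤ Λ := fun a ha b hb => hB (Submodule.mul_mem_mul ha hb)
    have hΛ : (Subalgebra.toSubmodule Λ).FG := by
      refine Submodule.fg_of_fg_map_injective (LinearMap.mulRight (𝓞 F) b)
        (fun x y hxy => mul_right_cancel₀ hb0 hxy) ?_
      have : IsNoetherian (𝓞 F) B := isNoetherian_of_fg_of_noetherian _ hfg
      refine isNoetherian_submodule.1 this _ ?_
      rintro _ ⟨y, hy, rfl⟩
      exact hy b hb
    rw [← hΔ.2 Λ (order_of_le hΔ.1 hle hΛ) hle]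
    exact hx
end

theorem statement0 (F D : Type) [Field F] [NumberField F] [DivisionRing D] [Algebra F D]
    [Algebra (𝓞 F) D] [IsScalarTower (𝓞 F) F D] [FiniteDimensional F D]
    -- D is central over F
    (hcentral : Subalgebra.center F D = ⊥)
    -- M is a full O_F-lattice in D
    (M : Submodule (𝓞 F) D) (hM : IsFullLattice F D M)
    -- Δ := O_l(M) is a maximal O_F-order
    (Δ : Subalgebra (𝓞 F) D) (hΔmax : IsMaximalOrder F D Δ)
    (hΔ : (Δ : Set D) = leftOrderSet (M : Set D)) :
    ((Submodule.span (𝓞 F) ((M : Set D) * invSet (M : Set D)) : Submodule (𝓞 F) D) : Set D)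
        = leftOrderSet (M : Set D) ∧
    ((Submodule.span (𝓞 F) (invSet (M : Set D) * (M : Set D)) : Submodule (𝓞 F) D) : Set D)
        = rightOrderSet (M : Set D) ∧
    invSet (invSet (M : Set D)) = (M : Set D) := by
  have h := goodOrd_of_max hΔmax
  have memΔ : ∀ x, x ∈ Δ ↔ ∀ m ∈ M, x * m ∈ M := by
    intro x
    have : x ∈ (Δ : Set D) ↔ x ∈ leftOrderSet (M : Set D) := by rw [hΔ]
    exact this
  have ml : ∀ a ∈ Δ, ∀ x ∈ M, a * x ∈ M := fun a ha => (memΔ a).1 ha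
  have nb : ∃ x ∈ M, x ≠ 0 := by
    by_contra hc
    push Not at hc
    have h1 : (1 : D) ∈ Submodule.span F (M : Set D) := by rw [hM.2]; trivial
    have h2 : Submodule.span F (M : Set D) = ⊥ := Submodule.span_eq_bot.2 hc
    rw [h2] at h1
    exact one_ne_zero ((Submodule.mem_bot F).1 h1)
  have hinv : invSet (M : Set D) = (dualL Δ M : Set D) := by
    ext x
    constructor
    · intro hx m hm
      exact (memΔ _).2 fun m' hm' => hx m hm m' hm'
    · intro hx m hm m' hm'
      exact ml _ (hx m hm) m' hm'
  obtain ⟨r, hr, hrM⟩ := h.exists_den hM.1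
  have e1 := h.mul_star hM.1 ml nb
  have e2 := h.star_mul ml nb r hr hrM
  rw [hinv, ← Submodule.mul_eq_span_mul_set, ← Submodule.mul_eq_span_mul_set, ← hΔ]
  have hMN : M * dualL Δ M ≤ Subalgebra.toSubmodule Δ :=
    Submodule.mul_le.2 fun m hm x hx => hx m hm
  have hMNM : M * dualL Δ M * M ≤ M :=
    Submodule.mul_le.2 fun x hx m hm => ml x (hMN hx) m hm
  refine ⟨?_, ?_, ?_⟩
  · refine Set.Subset.antisymm (fun x hx => hMN hx) fun x hx => ?_
    have : Subalgebra.toSubmodule Δ * (M * dualL Δ M) ≤ M * dualL Δ M := by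
      rw [← mul_assoc]
      exact mul_le_mul' (Submodule.mul_le.2 ml) le_rfl
    have h3 := this (Submodule.mul_mem_mul hx e1)
    rwa [mul_one] at h3
  · refine Set.Subset.antisymm (fun x hx m hm => ?_) fun x hx => ?_
    · apply hMNM
      rw [mul_assoc]
      exact Submodule.mul_mem_mul hm hx
    · have h4 : ∀ w ∈ dualL Δ M * M, w * x ∈ dualL Δ M * M := by
        intro w hw
        induction hw using Submodule.mul_induction_on' with
        | mem_mul_mem y hy m hm =>
          rw [mul_assoc]
          exact Submodule.mul_mem_mul hy (hx m hm)
        | add x _ y _ hx hy => rw [add_mul]; exact Submodule.add_mem _ hx hy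
      have h3 := h4 1 e2
      rwa [one_mul] at h3
  · refine Set.Subset.antisymm (fun y hy => ?_) fun m hm n hn n' hn' v hv => ?_
    · have h4 : ∀ w ∈ M * dualL Δ M, ∀ u ∈ dualL Δ M * M, w * y * u ∈ M := by
        intro w hw u hu
        induction hw using Submodule.mul_induction_on' with
        | mem_mul_mem m hm n hn =>
          induction hu using Submodule.mul_induction_on' with
          | mem_mul_mem n' hn' m' hm' =>
            have : m * n * y * (n' * m') = m * (n * y * n') * m' := by simp only [mul_assoc]
            rw [this]
            exact hMNM (Submodule.mul_mem_mul (Submodule.mul_mem_mul hm (hy n hn n' hn')) hm')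
          | add a _ b _ ha hb => rw [mul_add]; exact M.add_mem ha hb
        | add a _ b _ ha hb => rw [add_mul, add_mul]; exact M.add_mem ha hb
      have h3 := h4 1 e1 1 e2
      rwa [one_mul, mul_one] at h3
    · have : v * (n * m * n') = (v * n * m) * n' := by simp only [mul_assoc]
      rw [this]
      exact hn' _ (ml _ (hn v hv) m hm)
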